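/- Let X be a nonempty finite set, ε ∈ (0,1], δ ∈ [0,1], and let f̄ : X → [−1,1]. Let g : X → ℝ and g₁ : X → ℝ be measures with E_{x∈X} g(x) = E_{x∈X} g₁(x) = δ, and suppose ⟨g, f̄⟩ ≥ ⟨g₁, f̄⟩ + ε. Then there exists a threshold t ∈ [−1 + ε/3, 1] such that ⟨g, f̄_t⟩ ≥ ⟨g₁, f̄_{t−ε/3}⟩ + ε/3. -/

import Mathlib

/-- Normalized inner product `⟨f,g⟩ = (1/|X|) ∑ₓ f(x) g(x)`. -/
noncomputable def ip (X : Type) [Fintype X] (f g : X → ℝ) : ℝ :=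
  (∑ x, f x * g x) / (Fintype.card X)

/-- Expectation `E_{x∈X} g(x) = (1/|X|) ∑ₓ g(x)`. -/
noncomputable def ex (X : Type) [Fintype X] (g : X → ℝ) : ℝ :=
  (∑ x, g x) / (Fintype.card X)

/-- A measure on `X`: nonnegative with expectation at most 1. -/
def IsMeasure (X : Type) [Fintype X] (g : X → ℝ) : Prop :=
  (∀ x, 0 ≤ g x) ∧ ex X g ≤ 1

/-- The threshold function `f̄_t : f̄_t(x) = 1` iff `f̄(x) ≥ t`, else `0`. -/
noncomputable def thr {X : Type} (fbar : X → ℝ) (t : ℝ) : X → ℝ :=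
  fun x => if t ≤ fbar x then 1 else 0

lemma thr_int (a l u : ℝ) : IntervalIntegrable (fun t : ℝ => if t ≤ a then (1:ℝ) else 0)
    MeasureTheory.volume l u := by
  apply Antitone.intervalIntegrable
  intro s t hst
  by_cases h : t ≤ a
  · simp [h, hst.trans h]
  · simp only [h, if_false]
    split_ifs <;> norm_num

lemma thr_val (a l u : ℝ) (h : l ≤ u) :
    ∫ t in l..u, (if t ≤ a then (1:ℝ) else 0) = max (min u a - l) 0 := by
  have e : (fun t : ℝ => if t ≤ a then (1:ℝ) else 0) = (Set.Iic a).indicator (fun _ => (1:ℝ)) := by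
    ext t; simp [Set.indicator]
  rw [intervalIntegral.integral_of_le h, e, MeasureTheory.integral_indicator measurableSet_Iic,
    MeasureTheory.Measure.restrict_restrict measurableSet_Iic, Set.inter_comm, Set.Ioc_inter_Iic]
  simp [MeasureTheory.measureReal_def, ENNReal.toReal_ofReal']

theorem threshold_distinguisher
    (X : Type) [Fintype X] [Nonempty X]
    (ε δ : ℝ) (hε0 : 0 < ε) (hε1 : ε ≤ 1) (hδ0 : 0 ≤ δ) (hδ1 : δ ≤ 1)
    (fbar : X → ℝ) (hf : ∀ x, fbar x ∈ Set.Icc (-1 : ℝ) 1)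
    (g g₁ : X → ℝ) (hg : IsMeasure X g) (hg₁ : IsMeasure X g₁)
    (hEg : ex X g = δ) (hEg₁ : ex X g₁ = δ)
    (hdist : ip X g fbar ≥ ip X g₁ fbar + ε) :
    ∃ t : ℝ, -1 + ε / 3 ≤ t ∧ t ≤ 1 ∧
      ip X g (thr fbar t) ≥ ip X g₁ (thr fbar (t - ε / 3)) + ε / 3 := by
  by_contra! hcon
  have hN : (0:ℝ) < Fintype.card X := by exact_mod_cast Fintype.card_pos
  obtain ⟨η, rfl⟩ : ∃ η, ε = 3 * η := ⟨ε / 3, by ring⟩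
  have h3 : 3 * η / 3 = η := by ring
  simp only [h3, ip, ex, ge_iff_le] at *
  generalize (Fintype.card X : ℝ) = N at *
  have hle : -1 + η ≤ 1 := by linarith
  have sub : ∀ t a : ℝ, (t - η ≤ a) = (t ≤ a + η) := fun t a => by rw [sub_le_iff_le_add]
  have hcon2 : ∀ t ∈ Set.Icc (-1 + η) 1,
      ∑ x, g x * (if t ≤ fbar x then (1:ℝ) else 0) ≤
      (∑ x, g₁ x * (if t ≤ fbar x + η then (1:ℝ) else 0)) + η * N := by
    intro t ht
    have := (hcon t ht.1 ht.2).le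
    simp only [thr, sub] at this
    rw [div_add' _ _ _ hN.ne', div_le_div_iff_of_pos_right hN] at this
    exact this
  have i1 : ∀ x ∈ Finset.univ, IntervalIntegrable
      (fun t : ℝ => g x * (if t ≤ fbar x then (1:ℝ) else 0)) MeasureTheory.volume (-1 + η) 1 :=
    fun x _ => (thr_int _ _ _).const_mul _
  have i2 : ∀ x ∈ Finset.univ, IntervalIntegrable
      (fun t : ℝ => g₁ x * (if t ≤ fbar x + η then (1:ℝ) else 0)) MeasureTheory.volume (-1 + η) 1 :=
    fun x _ => (thr_int _ _ _).const_mul _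
  have s1 : IntervalIntegrable (fun t : ℝ => ∑ x, g x * (if t ≤ fbar x then (1:ℝ) else 0))
      MeasureTheory.volume (-1 + η) 1 := by
    simpa [Finset.sum_fn] using IntervalIntegrable.sum Finset.univ i1
  have s2 : IntervalIntegrable (fun t : ℝ => ∑ x, g₁ x * (if t ≤ fbar x + η then (1:ℝ) else 0))
      MeasureTheory.volume (-1 + η) 1 := by
    simpa [Finset.sum_fn] using IntervalIntegrable.sum Finset.univ i2
  have key := intervalIntegral.integral_mono_on hle s1
    (s2.add (intervalIntegrable_const (c := η * N))) hcon2
  rw [intervalIntegral.integral_add s2 intervalIntegrable_const,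
    intervalIntegral.integral_finsetSum i1, intervalIntegral.integral_finsetSum i2] at key
  simp only [intervalIntegral.integral_const_mul, thr_val _ _ _ hle,
    intervalIntegral.integral_const, smul_eq_mul] at key
  have b1 : ∑ x, g x * (fbar x + 1 - η) ≤ ∑ x, g x * max (min 1 (fbar x) - (-1 + η)) 0 := by
    refine Finset.sum_le_sum fun x _ => mul_le_mul_of_nonneg_left ?_ (hg.1 x)
    rw [min_eq_right (hf x).2]
    exact le_max_of_le_left (by linarith)
  have b2 : ∑ x, g₁ x * max (min 1 (fbar x + η) - (-1 + η)) 0 ≤ ∑ x, g₁ x * (fbar x + 1) := by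
    refine Finset.sum_le_sum fun x _ => mul_le_mul_of_nonneg_left ?_ (hg₁.1 x)
    have := (hf x).1
    exact max_le (by linarith [min_le_right 1 (fbar x + η)]) (by linarith)
  have e1 : ∑ x, g x * (fbar x + 1 - η) = ∑ x, g x * fbar x + (1 - η) * ∑ x, g x := by
    rw [Finset.mul_sum, ← Finset.sum_add_distrib]
    exact Finset.sum_congr rfl fun x _ => by ring
  have e2 : ∑ x, g₁ x * (fbar x + 1) = ∑ x, g₁ x * fbar x + ∑ x, g₁ x := by
    rw [← Finset.sum_add_distrib]
    exact Finset.sum_congr rfl fun x _ => by ring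
  rw [div_eq_iff hN.ne'] at hEg hEg₁
  rw [div_add' _ _ _ hN.ne', div_le_div_iff_of_pos_right hN] at hdist
  rw [e1, hEg] at b1
  rw [e2, hEg₁] at b2
  have hη : 0 < η := by linarith
  have p1 : 0 < η * η * N := by positivity
  have p2 : 0 ≤ (1 - δ) * (η * N) := mul_nonneg (by linarith) (by positivity)
  nlinarith
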